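/- In the MDP setup with a bounded measurable Λ : S×A → [1,∞) and τ(s,a) := 1/(1+Λ(s,a)), define the rectangular uncertainty set U(P) as the set of Markov kernels U from S×A to S such that for every (s,a), U(·|s,a) ≪ P(·|s,a) with Λ(s,a)⁻¹ ≤ dU(·|s,a)/dP(·|s,a) ≤ Λ(s,a) almost everywhere. Define Q⁻(s,a) := inf_{U ∈ U(P)} Q^π_U(s,a) and V⁻(s) := ∫ Q⁻(s,a) π(da|s), and assume Q⁻ is measurable. Then Q⁻ satisfies, for all (s,a): Q⁻(s,a) = r(s,a) + γ Λ(s,a)⁻¹ ∫ V⁻(s') P(ds'|s,a) + γ (1 − Λ(s,a)⁻¹) · CVaR⁻_{τ(s,a)}( V⁻ ; P(·|s,a) ). -/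

import Mathlib

open MeasureTheory ProbabilityTheory

/-- Lower conditional value-at-risk at level `τ`. -/
noncomputable def cvarLower {S : Type*} [MeasurableSpace S] (τ : ℝ) (v : S → ℝ)
    (P : Measure S) : ℝ :=
  ⨆ b : ℝ, b + τ⁻¹ * ∫ x, min (v x - b) 0 ∂P

/-- One step of the state-action chain under transition kernel `U` and policy `π`. -/
noncomputable def stepKernel {S A : Type*} [MeasurableSpace S] [MeasurableSpace A]
    (U : Kernel (S × A) S) (π : Kernel S A) : Kernel (S × A) (S × A) :=
  (Kernel.id ×ₖ π) ∘ₖ U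

/-- `t`-fold iterate of a kernel. -/
noncomputable def iterKernel {Z : Type*} [MeasurableSpace Z] (K : Kernel Z Z) :
    ℕ → Kernel Z Z
  | 0 => Kernel.id
  | n + 1 => K ∘ₖ iterKernel K n

/-- Q-function: `Q^π_U(s,a) = Σ_t γ^t E[r(s_t,a_t)]` for the chain started at `(s,a)`. -/
noncomputable def Qfun {S A : Type*} [MeasurableSpace S] [MeasurableSpace A]
    (U : Kernel (S × A) S) (π : Kernel S A) (r : S × A → ℝ) (γ : ℝ) (sa : S × A) : ℝ :=
  ∑' t : ℕ, γ ^ t * ∫ z, r z ∂(iterKernel (stepKernel U π) t sa)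

/-- The rectangular uncertainty set `U(P)`: Markov kernels `U` with, for every `(s,a)`,
`U(·|s,a) ≪ P(·|s,a)` and `Λ(s,a)⁻¹ ≤ dU(·|s,a)/dP(·|s,a) ≤ Λ(s,a)` a.e. -/
def kernelPerturbSet {S A : Type*} [MeasurableSpace S] [MeasurableSpace A]
    (Λ : S × A → ℝ) (P : Kernel (S × A) S) : Set (Kernel (S × A) S) :=
  {U | IsMarkovKernel U ∧ ∀ sa : S × A,
    U sa ≪ P sa ∧
    ∀ᵐ s' ∂(P sa), ENNReal.ofReal (Λ sa)⁻¹ ≤ (U sa).rnDeriv (P sa) s' ∧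
      (U sa).rnDeriv (P sa) s' ≤ ENNReal.ofReal (Λ sa)}

/-- The worst-case robust `Q`-function `Q⁻(s,a) = inf_{U ∈ U(P)} Q^π_U(s,a)`. -/
noncomputable def Qrobust {S A : Type*} [MeasurableSpace S] [MeasurableSpace A]
    (Λ : S × A → ℝ) (P : Kernel (S × A) S) (π : Kernel S A) (r : S × A → ℝ) (γ : ℝ)
    (sa : S × A) : ℝ :=
  ⨅ U : kernelPerturbSet Λ P, Qfun (U : Kernel (S × A) S) π r γ sa

/-- The worst-case robust value function `V⁻(s) = ∫ Q⁻(s,a) π(da|s)`. -/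
noncomputable def Vrobust {S A : Type*} [MeasurableSpace S] [MeasurableSpace A]
    (Λ : S × A → ℝ) (P : Kernel (S × A) S) (π : Kernel S A) (r : S × A → ℝ) (γ : ℝ)
    (s : S) : ℝ :=
  ∫ a, Qrobust Λ P π r γ (s, a) ∂(π s)

section Bounded

variable {Z : Type*} [MeasurableSpace Z] {μ : Measure Z} [IsProbabilityMeasure μ]
  {f : Z → ℝ} {a b : ℝ}

lemma integrable_of_forall_mem_Icc (hf : Measurable f) (h : ∀ z, f z ∈ Set.Icc a b) :
    Integrable f μ :=
  Integrable.of_mem_Icc a b hf.aemeasurable (ae_of_all _ h)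

lemma integral_mem_Icc_of_forall (hf : Measurable f) (h : ∀ z, f z ∈ Set.Icc a b) :
    ∫ z, f z ∂μ ∈ Set.Icc a b := by
  have hi : Integrable f μ := integrable_of_forall_mem_Icc hf h
  constructor
  · simpa using integral_mono (integrable_const a) hi fun z => (h z).1
  · simpa using integral_mono hi (integrable_const b) fun z => (h z).2

lemma measurable_integral_kernel {Y : Type*} [MeasurableSpace Y] {κ : Kernel Y Z}
    (hf : Measurable f) : Measurable fun y => ∫ z, f z ∂(κ y) :=
  (StronglyMeasurable.integral_kernel hf.stronglyMeasurable).measurable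

end Bounded

section Chain

variable {Z : Type*} [MeasurableSpace Z]

instance iterKernel.instIsMarkovKernel (K : Kernel Z Z) [IsMarkovKernel K] (n : ℕ) :
    IsMarkovKernel (iterKernel K n) := by
  induction n with
  | zero => unfold iterKernel; infer_instance
  | succ n ih => unfold iterKernel; infer_instance

lemma iterKernel_succ' (K : Kernel Z Z) (n : ℕ) :
    iterKernel K (n + 1) = iterKernel K n ∘ₖ K := by
  induction n with
  | zero => simp [iterKernel]
  | succ n ih =>
    rw [iterKernel, ih, ← Kernel.comp_assoc, ← iterKernel, ih]

variable {S A : Type*} [MeasurableSpace S] [MeasurableSpace A]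

instance stepKernel.instIsMarkovKernel (U : Kernel (S × A) S) [IsMarkovKernel U]
    (π : Kernel S A) [IsMarkovKernel π] : IsMarkovKernel (stepKernel U π) := by
  unfold stepKernel; infer_instance

lemma integral_stepKernel (U : Kernel (S × A) S) [IsMarkovKernel U]
    (π : Kernel S A) [IsMarkovKernel π] {f : S × A → ℝ} {a b : ℝ} (hf : Measurable f)
    (h : ∀ z, f z ∈ Set.Icc a b) (z : S × A) :
    ∫ y, f y ∂(stepKernel U π z) = ∫ s, ∫ a, f (s, a) ∂(π s) ∂(U z) := by
  have hi : Integrable f (stepKernel U π z) := integrable_of_forall_mem_Icc hf h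
  have heq : stepKernel U π z = U z ⊗ₘ π := by
    rw [Measure.compProd_eq_comp_prod]; rfl
  rw [heq] at hi ⊢
  exact Measure.integral_compProd hi

variable {U : Kernel (S × A) S} {π : Kernel S A} {r : S × A → ℝ} {γ : ℝ}

lemma measurable_Qfun (hr : Measurable r) : Measurable (Qfun U π r γ) := by
  unfold Qfun
  exact Measurable.tsum fun t => (measurable_integral_kernel hr).const_mul _

variable [IsMarkovKernel U] [IsMarkovKernel π]

lemma summable_discounted_reward (hr : Measurable r) (hr01 : ∀ z, r z ∈ Set.Icc (0 : ℝ) 1)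
    (hγ : γ ∈ Set.Ico (0 : ℝ) 1) (z : S × A) :
    Summable fun t : ℕ => γ ^ t * ∫ y, r y ∂(iterKernel (stepKernel U π) t z) := by
  refine Summable.of_nonneg_of_le (fun t => ?_) (fun t => ?_)
    (summable_geometric_of_lt_one hγ.1 hγ.2)
  · exact mul_nonneg (pow_nonneg hγ.1 t) (integral_mem_Icc_of_forall hr hr01).1
  · exact mul_le_of_le_one_right (pow_nonneg hγ.1 t) (integral_mem_Icc_of_forall hr hr01).2

lemma Qfun_mem_Icc (hr : Measurable r) (hr01 : ∀ z, r z ∈ Set.Icc (0 : ℝ) 1)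
    (hγ : γ ∈ Set.Ico (0 : ℝ) 1) (z : S × A) :
    Qfun U π r γ z ∈ Set.Icc (0 : ℝ) (1 - γ)⁻¹ := by
  constructor
  · exact tsum_nonneg fun t =>
      mul_nonneg (pow_nonneg hγ.1 t) (integral_mem_Icc_of_forall hr hr01).1
  · rw [← tsum_geometric_of_lt_one hγ.1 hγ.2]
    exact (summable_discounted_reward hr hr01 hγ z).tsum_le_tsum
      (fun t => mul_le_of_le_one_right (pow_nonneg hγ.1 t)
        (integral_mem_Icc_of_forall hr hr01).2)
      (summable_geometric_of_lt_one hγ.1 hγ.2)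

/-- Bellman evaluation equation for a fixed transition kernel. -/
lemma Qfun_eq_add_integral (hr : Measurable r) (hr01 : ∀ z, r z ∈ Set.Icc (0 : ℝ) 1)
    (hγ : γ ∈ Set.Ico (0 : ℝ) 1) (z : S × A) :
    Qfun U π r γ z = r z + γ * ∫ y, Qfun U π r γ y ∂(stepKernel U π z) := by
  set K := stepKernel U π with hK
  have hm (t : ℕ) : Measurable fun y => ∫ x, r x ∂(iterKernel K t y) :=
    measurable_integral_kernel hr
  have h01 (t : ℕ) (y : S × A) : ∫ x, r x ∂(iterKernel K t y) ∈ Set.Icc (0 : ℝ) 1 :=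
    integral_mem_Icc_of_forall hr hr01
  have hstep (t : ℕ) : ∫ x, r x ∂(iterKernel K (t + 1) z)
      = ∫ y, ∫ x, r x ∂(iterKernel K t y) ∂(K z) := by
    rw [iterKernel_succ']
    refine Kernel.integral_comp ?_
    rw [← iterKernel_succ']
    exact integrable_of_forall_mem_Icc hr hr01
  have hint (t : ℕ) :
      Integrable (fun y => γ ^ t * ∫ x, r x ∂(iterKernel K t y)) (K z) :=
    (integrable_of_forall_mem_Icc (hm t) (h01 t)).const_mul _
  have hnorm (t : ℕ) : ∫ y, ‖γ ^ t * ∫ x, r x ∂(iterKernel K t y)‖ ∂(K z)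
      = γ ^ t * ∫ x, r x ∂(iterKernel K (t + 1) z) := by
    rw [hstep, ← integral_const_mul]
    refine integral_congr_ae (ae_of_all _ fun y => ?_)
    exact Real.norm_of_nonneg (mul_nonneg (pow_nonneg hγ.1 t) (h01 t y).1)
  have hsum : Summable fun t => ∫ y, ‖γ ^ t * ∫ x, r x ∂(iterKernel K t y)‖ ∂(K z) := by
    simp_rw [hnorm]
    refine Summable.of_nonneg_of_le (fun t => ?_) (fun t => ?_)
      (summable_geometric_of_lt_one hγ.1 hγ.2)
    · exact mul_nonneg (pow_nonneg hγ.1 t) (h01 _ z).1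
    · exact mul_le_of_le_one_right (pow_nonneg hγ.1 t) (h01 _ z).2
  have hswap : ∫ y, Qfun U π r γ y ∂(K z)
      = ∑' t, γ ^ t * ∫ x, r x ∂(iterKernel K (t + 1) z) := by
    unfold Qfun
    rw [← hK, ← (hasSum_integral_of_summable_integral_norm hint hsum).tsum_eq]
    exact tsum_congr fun t => by rw [integral_const_mul, hstep]
  rw [hswap, ← tsum_mul_left]
  unfold Qfun
  rw [(summable_discounted_reward hr hr01 hγ z).tsum_eq_zero_add, ← hK]
  congr 1
  · simp [iterKernel, Kernel.id_apply, integral_dirac' _ _ hr.stronglyMeasurable]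
  · exact tsum_congr fun t => by ring

end Chain

section CVaR

variable {S : Type*} [MeasurableSpace S] {v : S → ℝ} {ν μ : Measure S}
  {l : ℝ}

/-- Lower `τ`-quantile of `v` under `ν`. -/
noncomputable def lowerQuantile (τ : ℝ) (v : S → ℝ) (ν : Measure S) : ℝ :=
  sInf {x | τ ≤ ν.real {y | v y ≤ x}}

/-- Value on the quantile level set that normalises the worst-case density. -/
noncomputable def worstCaseWeight (l q : ℝ) (v : S → ℝ) (ν : Measure S) : ℝ :=
  max l⁻¹ (min l ((1 - l * ν.real {y | v y < q} - l⁻¹ * ν.real {y | q < v y})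
    / ν.real {y | v y = q}))

/-- The density in `[l⁻¹, l]` which minimises the expectation of `v`. -/
noncomputable def worstCaseDensity (l : ℝ) (v : S → ℝ) (ν : Measure S) (x : S) : ℝ :=
  if v x < lowerQuantile (1 + l)⁻¹ v ν then l
  else if lowerQuantile (1 + l)⁻¹ v ν < v x then l⁻¹
  else worstCaseWeight l (lowerQuantile (1 + l)⁻¹ v ν) v ν

lemma worstCaseDensity_mem_Icc (hl : 1 ≤ l) (x : S) :
    worstCaseDensity l v ν x ∈ Set.Icc l⁻¹ l := by
  have h : l⁻¹ ≤ l := (inv_le_one_of_one_le₀ hl).trans hl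
  unfold worstCaseDensity worstCaseWeight
  split_ifs
  · exact ⟨h, le_rfl⟩
  · exact ⟨le_rfl, h⟩
  · exact ⟨le_max_left _ _, max_le h (min_le_left _ _)⟩

lemma measurable_worstCaseDensity (hv : Measurable v) :
    Measurable (worstCaseDensity l v ν) :=
  Measurable.ite (measurableSet_lt hv measurable_const) measurable_const
    (Measurable.ite (measurableSet_lt measurable_const hv) measurable_const measurable_const)

lemma worstCaseDensity_sub_mul (l : ℝ) (v : S → ℝ) (ν : Measure S) (x : S) :
    (worstCaseDensity l v ν x - l⁻¹) * (v x - lowerQuantile (1 + l)⁻¹ v ν)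
      = (l - l⁻¹) * min (v x - lowerQuantile (1 + l)⁻¹ v ν) 0 := by
  unfold worstCaseDensity
  split_ifs with h h'
  · rw [min_eq_left (by linarith)]
  · rw [min_eq_right (by linarith)]; ring
  · rw [le_antisymm (not_lt.1 h') (not_lt.1 h)]; simp

variable [IsProbabilityMeasure ν] [IsProbabilityMeasure μ]

lemma integrable_min_sub (hv : Integrable v ν) (b : ℝ) :
    Integrable (fun x => min (v x - b) 0) ν :=
  (hv.sub (integrable_const b)).inf (integrable_const 0)

lemma bddAbove_cvarLower {τ : ℝ} (hτ : 1 ≤ τ⁻¹) (hv : Integrable v ν) :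
    BddAbove (Set.range fun b : ℝ => b + τ⁻¹ * ∫ x, min (v x - b) 0 ∂ν) := by
  refine ⟨∫ x, v x ∂ν, ?_⟩
  rintro _ ⟨b, rfl⟩
  have h0 : ∫ x, min (v x - b) 0 ∂ν ≤ 0 := integral_nonpos fun x => min_le_right _ _
  have h1 : ∫ x, min (v x - b) 0 ∂ν ≤ ∫ x, (v x - b) ∂ν :=
    integral_mono (integrable_min_sub hv b) (hv.sub (integrable_const b))
      fun x => min_le_left _ _
  rw [integral_sub hv (integrable_const b)] at h1
  simp only [integral_const, probReal_univ, smul_eq_mul, one_mul] at h1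
  dsimp only
  nlinarith

/-- Decomposition of an expectation under `μ` around the level `b` of the density. -/
lemma integral_eq_add_integral_rnDeriv (hμν : μ ≪ ν) (hvν : Integrable v ν)
    (hvμ : Integrable v μ) (b : ℝ) :
    ∫ x, v x ∂μ = b + l⁻¹ * (∫ x, v x ∂ν - b)
      + ∫ x, ((μ.rnDeriv ν x).toReal - l⁻¹) * (v x - b) ∂ν := by
  have hsub : Integrable (fun x => v x - b) μ := hvμ.sub (integrable_const b)
  have hsub' : Integrable (fun x => v x - b) ν := hvν.sub (integrable_const b)
  have h1 : Integrable (fun x => (μ.rnDeriv ν x).toReal * (v x - b)) ν :=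
    (integrable_rnDeriv_smul_iff hμν).2 hsub
  have h2 : ∫ x, (μ.rnDeriv ν x).toReal * (v x - b) ∂ν = ∫ x, (v x - b) ∂μ :=
    integral_rnDeriv_smul hμν
  simp_rw [sub_mul]
  rw [integral_sub h1 (hsub'.const_mul _), h2, integral_const_mul,
    integral_sub hvμ (integrable_const b), integral_sub hvν (integrable_const b)]
  simp

lemma one_sub_inv_mul_objective (hl : 1 ≤ l) (b I : ℝ) :
    (1 - l⁻¹) * (b + ((1 + l)⁻¹)⁻¹ * I) = b - l⁻¹ * b + (l - l⁻¹) * I := by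
  rw [inv_inv]
  field_simp
  ring

lemma cvar_mixture_le_integral (hl : 1 ≤ l) (hμν : μ ≪ ν) (hvν : Integrable v ν)
    (hvμ : Integrable v μ)
    (hd : ∀ᵐ x ∂ν, ENNReal.ofReal l⁻¹ ≤ μ.rnDeriv ν x ∧ μ.rnDeriv ν x ≤ ENNReal.ofReal l) :
    l⁻¹ * ∫ x, v x ∂ν + (1 - l⁻¹) * cvarLower (1 + l)⁻¹ v ν ≤ ∫ x, v x ∂μ := by
  have hl0 : 0 < l := by linarith
  have h1 : 0 ≤ 1 - l⁻¹ := sub_nonneg.2 (inv_le_one_of_one_le₀ hl)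
  rw [← le_sub_iff_add_le', cvarLower, Real.mul_iSup_of_nonneg h1]
  refine ciSup_le fun b => ?_
  rw [one_sub_inv_mul_objective hl, integral_eq_add_integral_rnDeriv (l := l) hμν hvν hvμ b,
    ← integral_const_mul]
  have hint : Integrable (fun x => ((μ.rnDeriv ν x).toReal - l⁻¹) * (v x - b)) ν := by
    simp_rw [sub_mul]
    exact ((integrable_rnDeriv_smul_iff hμν).2 (hvμ.sub (integrable_const b))).sub
      ((hvν.sub (integrable_const b)).const_mul _)
  have hmono : ∫ x, (l - l⁻¹) * min (v x - b) 0 ∂ν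
      ≤ ∫ x, ((μ.rnDeriv ν x).toReal - l⁻¹) * (v x - b) ∂ν := by
    refine integral_mono_ae ((integrable_min_sub hvν b).const_mul _) hint ?_
    filter_upwards [hd] with x hx
    have hlo : l⁻¹ ≤ (μ.rnDeriv ν x).toReal :=
      (ENNReal.ofReal_le_iff_le_toReal (ne_top_of_le_ne_top ENNReal.ofReal_ne_top hx.2)).1 hx.1
    have hhi : (μ.rnDeriv ν x).toReal ≤ l := ENNReal.toReal_le_of_le_ofReal hl0.le hx.2
    rcases le_total (v x - b) 0 with h | h
    · rw [min_eq_left h]; nlinarith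
    · rw [min_eq_right h]; nlinarith
  linarith

lemma lowerQuantile_le_iff {τ : ℝ} (hτ : τ ∈ Set.Ioo (0 : ℝ) 1) (hv : Measurable v) (x : ℝ) :
    lowerQuantile τ v ν ≤ x ↔ τ ≤ ν.real {y | v y ≤ x} := by
  have : IsProbabilityMeasure (ν.map v) := Measure.isProbabilityMeasure_map hv.aemeasurable
  have hcdf (x : ℝ) : ν.real {y | v y ≤ x} = cdf (ν.map v) x := by
    rw [cdf_eq_real, map_measureReal_apply hv measurableSet_Iic]; rfl
  have hmono := monotone_cdf (ν.map v)
  unfold lowerQuantile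
  simp_rw [hcdf]
  have hbdd : BddBelow {x | τ ≤ cdf (ν.map v) x} := by
    obtain ⟨c, hc⟩ := ((tendsto_cdf_atBot (ν.map v)).eventually_lt_const hτ.1).exists
    exact ⟨c, fun x hx => le_of_not_gt fun h => (hc.trans_le hx).not_ge (hmono h.le)⟩
  have hne : {x | τ ≤ cdf (ν.map v) x}.Nonempty := by
    obtain ⟨c, hc⟩ := ((tendsto_cdf_atTop (ν.map v)).eventually_const_lt hτ.2).exists
    exact ⟨c, hc.le⟩
  refine ⟨fun h => ?_, fun h => csInf_le hbdd h⟩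
  refine le_trans ?_ (hmono h)
  have hright := ((cdf (ν.map v)).right_continuous
    (sInf {x | τ ≤ cdf (ν.map v) x})).tendsto.mono_left
      (nhdsWithin_mono _ Set.Ioi_subset_Ici_self)
  refine ge_of_tendsto hright ?_
  filter_upwards [self_mem_nhdsWithin] with y hy
  obtain ⟨c, hc, hcy⟩ := exists_lt_of_csInf_lt hne hy
  exact le_trans hc (hmono hcy.le)

lemma measureReal_lt_lowerQuantile_le {τ : ℝ} (hτ : τ ∈ Set.Ioo (0 : ℝ) 1)
    (hv : Measurable v) : ν.real {y | v y < lowerQuantile τ v ν} ≤ τ := by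
  set q := lowerQuantile τ v ν with hq
  obtain ⟨u, hu, huq, hlim⟩ := exists_seq_strictMono_tendsto q
  have hU : {y | v y < q} = ⋃ n, {y | v y ≤ u n} := by
    ext y
    simp only [Set.mem_ofPred_eq, Set.mem_iUnion]
    refine ⟨fun h => ?_, fun ⟨n, hn⟩ => hn.trans_lt (huq n)⟩
    obtain ⟨n, hn⟩ := (hlim.eventually_const_lt h).exists
    exact ⟨n, hn.le⟩
  have hm : Monotone fun n => {y | v y ≤ u n} :=
    fun i j hij y hy => le_trans hy (hu.monotone hij)
  have ht := (ENNReal.continuousAt_toReal (measure_ne_top ν _)).tendsto.comp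
    (tendsto_measure_iUnion_atTop (μ := ν) hm)
  rw [hU]
  refine le_of_tendsto ht (Filter.Eventually.of_forall fun n => ?_)
  exact (lt_of_not_ge fun h =>
    (huq n).not_ge ((lowerQuantile_le_iff hτ hv (u n)).2 h)).le

lemma integral_worstCaseDensity (hl : 1 ≤ l) (hv : Measurable v) :
    ∫ x, worstCaseDensity l v ν x ∂ν = 1 := by
  have hl0 : 0 < l := by linarith
  have hτ : (1 + l)⁻¹ ∈ Set.Ioo (0 : ℝ) 1 :=
    ⟨by positivity, inv_lt_one_of_one_lt₀ (by linarith)⟩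
  have hlt := measureReal_lt_lowerQuantile_le (ν := ν) hτ hv
  have hle := (lowerQuantile_le_iff (ν := ν) hτ hv _).1 le_rfl
  have hden : worstCaseDensity l v ν =
      {y | v y < lowerQuantile (1 + l)⁻¹ v ν}.indicator (fun _ => l)
      + {y | lowerQuantile (1 + l)⁻¹ v ν < v y}.indicator (fun _ => l⁻¹)
      + {y | v y = lowerQuantile (1 + l)⁻¹ v ν}.indicator
        (fun _ => worstCaseWeight l (lowerQuantile (1 + l)⁻¹ v ν) v ν) := by
    funext x
    rcases lt_trichotomy (v x) (lowerQuantile (1 + l)⁻¹ v ν) with h | h | h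
    · simp [worstCaseDensity, h, h.ne, h.not_gt]
    · simp [worstCaseDensity, h]
    · simp [worstCaseDensity, h, h.ne', h.not_gt]
  rw [hden]
  clear hden
  set q := lowerQuantile (1 + l)⁻¹ v ν
  have m1 : MeasurableSet {y | v y < q} := measurableSet_lt hv measurable_const
  have m2 : MeasurableSet {y | q < v y} := measurableSet_lt measurable_const hv
  have m3 : MeasurableSet {y | v y = q} := measurableSet_eq_fun hv measurable_const
  have i1 := (integrable_const (μ := ν) l).indicator m1
  have i2 := (integrable_const (μ := ν) l⁻¹).indicator m2
  have i3 := (integrable_const (μ := ν) (worstCaseWeight l q v ν)).indicator m3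
  rw [integral_add' (i1.add i2) i3, integral_add' i1 i2, integral_indicator_const _ m1,
    integral_indicator_const _ m2, integral_indicator_const _ m3]
  have hle_add : ν.real {y | v y ≤ q} = ν.real {y | v y < q} + ν.real {y | v y = q} := by
    rw [← measureReal_union _ m3]
    · congr 1; ext y; exact le_iff_lt_or_eq (a := v y) (b := q)
    · exact Set.disjoint_left.2 fun y h h' => LT.lt.ne (a := v y) (b := q) h h'
  have htotal : ν.real {y | v y ≤ q} + ν.real {y | q < v y} = 1 := by
    rw [← measureReal_union _ m2]
    · convert probReal_univ (μ := ν)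
      ext y; simpa using le_or_gt (v y) q
    · exact Set.disjoint_left.2 fun y h h' => not_lt_of_ge (a := v y) (b := q) h h'
  unfold worstCaseWeight
  have hp : 0 ≤ ν.real {y | v y = q} := measureReal_nonneg
  set p₁ := ν.real {y | v y < q}
  set p₂ := ν.real {y | q < v y}
  set p₀ := ν.real {y | v y = q}
  rw [hle_add] at hle htotal
  have hlt' : p₁ * (1 + l) ≤ 1 := by
    rwa [← le_div_iff₀ (by positivity), one_div]
  have hle' : 1 ≤ (p₁ + p₀) * (1 + l) := by
    rwa [← div_le_iff₀ (by positivity), one_div]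
  have hp₂ : p₂ = 1 - p₁ - p₀ := by linarith
  have hkey (c : ℝ) : 1 - l * p₁ - l⁻¹ * p₂ - c * p₀
      = l⁻¹ * ((l - 1) * (1 - p₁ * (1 + l))) + (l⁻¹ - c) * p₀ := by
    rw [hp₂]; field_simp; ring
  have hlinv : l⁻¹ * l = 1 := inv_mul_cancel₀ hl0.ne'
  have hlpos : 0 < l⁻¹ := inv_pos.2 hl0
  rcases hp.eq_or_lt with h0 | h0
  · have := hkey 0
    rw [← h0] at this hle' ⊢
    have h1 : p₁ * (1 + l) = 1 := by linarith
    simp only [h1] at this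
    simp only [smul_eq_mul]
    linarith
  · have hlow : l⁻¹ ≤ (1 - l * p₁ - l⁻¹ * p₂) / p₀ := by
      rw [le_div_iff₀ h0, ← sub_nonneg, hkey]
      have : 0 ≤ l⁻¹ * ((l - 1) * (1 - p₁ * (1 + l))) :=
        mul_nonneg hlpos.le (mul_nonneg (by linarith) (by linarith))
      linarith
    have hupp : (1 - l * p₁ - l⁻¹ * p₂) / p₀ ≤ l := by
      rw [div_le_iff₀ h0, ← sub_nonpos, hkey]
      have h3 : l⁻¹ * ((l - 1) * (1 - p₁ * (1 + l))) + (l⁻¹ - l) * p₀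
          = l⁻¹ * (l - 1) * (1 - (p₁ + p₀) * (1 + l)) := by field_simp; ring
      rw [h3]
      exact mul_nonpos_of_nonneg_of_nonpos (mul_nonneg hlpos.le (by linarith)) (by linarith)
    rw [min_eq_right hupp, max_eq_right hlow]
    simp only [smul_eq_mul]
    rw [mul_div_cancel₀ _ h0.ne']
    ring

/-- The worst-case density attains the mixture of mean and lower CVaR from below. -/
lemma integral_le_cvar_mixture (hl : 1 ≤ l) (hvν : Integrable v ν) (hvμ : Integrable v μ)
    (hμν : μ ≪ ν)
    (hd : μ.rnDeriv ν =ᵐ[ν] fun x => ENNReal.ofReal (worstCaseDensity l v ν x)) :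
    ∫ x, v x ∂μ ≤ l⁻¹ * ∫ x, v x ∂ν + (1 - l⁻¹) * cvarLower (1 + l)⁻¹ v ν := by
  have h1 : 0 ≤ 1 - l⁻¹ := sub_nonneg.2 (inv_le_one_of_one_le₀ hl)
  have hle := mul_le_mul_of_nonneg_left
    (le_ciSup (bddAbove_cvarLower (τ := (1 + l)⁻¹) (by rw [inv_inv]; linarith) hvν)
      (lowerQuantile (1 + l)⁻¹ v ν)) h1
  rw [one_sub_inv_mul_objective hl] at hle
  have heq : ∫ x, ((μ.rnDeriv ν x).toReal - l⁻¹) * (v x - lowerQuantile (1 + l)⁻¹ v ν) ∂ν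
      = (l - l⁻¹) * ∫ x, min (v x - lowerQuantile (1 + l)⁻¹ v ν) 0 ∂ν := by
    rw [← integral_const_mul]
    refine integral_congr_ae ?_
    filter_upwards [hd] with x hx
    rw [hx, ENNReal.toReal_ofReal
      ((inv_nonneg.2 (by linarith)).trans (worstCaseDensity_mem_Icc hl x).1),
      worstCaseDensity_sub_mul]
  rw [integral_eq_add_integral_rnDeriv (l := l) hμν hvν hvμ (lowerQuantile (1 + l)⁻¹ v ν), heq]
  unfold cvarLower
  linarith

end CVaR

section Robust

variable {S A : Type*} [MeasurableSpace S] [MeasurableSpace A]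
  {P : Kernel (S × A) S} [IsMarkovKernel P] {Λ : S × A → ℝ} {v : S → ℝ}

lemma self_mem_kernelPerturbSet (hΛ : ∀ sa, 1 ≤ Λ sa) : P ∈ kernelPerturbSet Λ P := by
  refine ⟨inferInstance, fun sa => ⟨Measure.AbsolutelyContinuous.rfl, ?_⟩⟩
  filter_upwards [Measure.rnDeriv_self (P sa)] with x hx
  rw [hx]
  exact ⟨ENNReal.ofReal_le_one.2 (inv_le_one_of_one_le₀ (hΛ sa)),
    ENNReal.one_le_ofReal.2 (hΛ sa)⟩

lemma measurable_lowerQuantile_kernel {τ : S × A → ℝ} (hτ : Measurable τ)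
    (hτ01 : ∀ sa, τ sa ∈ Set.Ioo (0 : ℝ) 1) (hv : Measurable v) :
    Measurable fun sa => lowerQuantile (τ sa) v (P sa) := by
  refine measurable_of_Iic fun x => ?_
  have h : (fun sa => lowerQuantile (τ sa) v (P sa)) ⁻¹' Set.Iic x
      = {sa | τ sa ≤ (P sa).real {y | v y ≤ x}} := by
    ext sa
    exact lowerQuantile_le_iff (hτ01 sa) hv x
  rw [h]
  exact measurableSet_le hτ
    (P.measurable_coe (measurableSet_le hv measurable_const)).ennreal_toReal

lemma measurable_worstCaseDensity_kernel (hΛ_meas : Measurable Λ) (hΛ : ∀ sa, 1 ≤ Λ sa)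
    (hv : Measurable v) :
    Measurable (Function.uncurry fun sa x => worstCaseDensity (Λ sa) v (P sa) x) := by
  have hq : Measurable fun sa => lowerQuantile (1 + Λ sa)⁻¹ v (P sa) :=
    measurable_lowerQuantile_kernel (hΛ_meas.const_add 1).inv
      (fun sa => ⟨inv_pos.2 (by linarith [hΛ sa]),
        inv_lt_one_of_one_lt₀ (by linarith [hΛ sa])⟩) hv
  set q := fun sa => lowerQuantile (1 + Λ sa)⁻¹ v (P sa)
  have mlt : MeasurableSet {p : (S × A) × S | v p.2 < q p.1} :=
    measurableSet_lt (hv.comp measurable_snd) (hq.comp measurable_fst)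
  have mgt : MeasurableSet {p : (S × A) × S | q p.1 < v p.2} :=
    measurableSet_lt (hq.comp measurable_fst) (hv.comp measurable_snd)
  have meq : MeasurableSet {p : (S × A) × S | v p.2 = q p.1} :=
    measurableSet_eq_fun (hv.comp measurable_snd) (hq.comp measurable_fst)
  have hlt : Measurable fun sa => (P sa).real {y | v y < q sa} :=
    (Kernel.measurable_kernel_prodMk_left mlt).ennreal_toReal
  have hgt : Measurable fun sa => (P sa).real {y | q sa < v y} :=
    (Kernel.measurable_kernel_prodMk_left mgt).ennreal_toReal
  have heq : Measurable fun sa => (P sa).real {y | v y = q sa} :=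
    (Kernel.measurable_kernel_prodMk_left meq).ennreal_toReal
  have hw : Measurable fun sa => worstCaseWeight (Λ sa) (q sa) v (P sa) := by
    unfold worstCaseWeight
    fun_prop
  exact Measurable.ite mlt (hΛ_meas.comp measurable_fst)
    (Measurable.ite mgt (hΛ_meas.inv.comp measurable_fst) (hw.comp measurable_fst))

/-- A single admissible kernel is worst-case for `v` simultaneously at all state-action pairs. -/
lemma exists_worstCaseKernel (hΛ_meas : Measurable Λ) (hΛ : ∀ sa, 1 ≤ Λ sa)
    (hv : Measurable v) {a b : ℝ} (hvb : ∀ s, v s ∈ Set.Icc a b) :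
    ∃ U ∈ kernelPerturbSet Λ P, ∀ sa, ∫ x, v x ∂(U sa) ≤
      (Λ sa)⁻¹ * ∫ x, v x ∂(P sa)
        + (1 - (Λ sa)⁻¹) * cvarLower (1 + Λ sa)⁻¹ v (P sa) := by
  have hmeas : Measurable (Function.uncurry fun sa x =>
      ENNReal.ofReal (worstCaseDensity (Λ sa) v (P sa) x)) :=
    (measurable_worstCaseDensity_kernel hΛ_meas hΛ hv).ennreal_ofReal
  set U := P.withDensity fun sa x => ENNReal.ofReal (worstCaseDensity (Λ sa) v (P sa) x)
  have hU (sa : S × A) : U sa = (P sa).withDensity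
      fun x => ENNReal.ofReal (worstCaseDensity (Λ sa) v (P sa) x) :=
    Kernel.withDensity_apply P hmeas sa
  have hac (sa : S × A) : U sa ≪ P sa := by
    rw [hU]; exact withDensity_absolutelyContinuous _ _
  have hd (sa : S × A) : (U sa).rnDeriv (P sa) =ᵐ[P sa]
      fun x => ENNReal.ofReal (worstCaseDensity (Λ sa) v (P sa) x) := by
    rw [hU]
    exact Measure.rnDeriv_withDensity _ (measurable_worstCaseDensity hv).ennreal_ofReal
  have hmarkov : IsMarkovKernel U := by
    refine ⟨fun sa => ⟨?_⟩⟩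
    rw [hU, withDensity_apply _ MeasurableSet.univ, Measure.restrict_univ,
      ← ofReal_integral_eq_lintegral_ofReal, integral_worstCaseDensity (hΛ sa) hv,
      ENNReal.ofReal_one]
    · exact integrable_of_forall_mem_Icc (measurable_worstCaseDensity hv)
        (worstCaseDensity_mem_Icc (hΛ sa))
    · exact ae_of_all _ fun x => (inv_nonneg.2 (by linarith [hΛ sa])).trans
        (worstCaseDensity_mem_Icc (hΛ sa) x).1
  refine ⟨U, ⟨hmarkov, fun sa => ⟨hac sa, ?_⟩⟩, fun sa => ?_⟩
  · filter_upwards [hd sa] with x hx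
    rw [hx]
    exact ⟨ENNReal.ofReal_le_ofReal (worstCaseDensity_mem_Icc (hΛ sa) x).1,
      ENNReal.ofReal_le_ofReal (worstCaseDensity_mem_Icc (hΛ sa) x).2⟩
  · exact integral_le_cvar_mixture (hΛ sa) (integrable_of_forall_mem_Icc hv hvb)
      (integrable_of_forall_mem_Icc hv hvb) (hac sa) (hd sa)

/-- A bounded supersolution of the Bellman evaluation equation dominates the Q-function. -/
lemma Qfun_le_of_supersolution {U : Kernel (S × A) S} [IsMarkovKernel U] {π : Kernel S A}
    [IsMarkovKernel π] {r f : S × A → ℝ} {γ M : ℝ} (hr : Measurable r)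
    (hr01 : ∀ z, r z ∈ Set.Icc (0 : ℝ) 1) (hγ : γ ∈ Set.Ico (0 : ℝ) 1) (hf : Measurable f)
    (hfM : ∀ z, f z ∈ Set.Icc (0 : ℝ) M)
    (hsup : ∀ z, r z + γ * ∫ y, f y ∂(stepKernel U π z) ≤ f z) (z : S × A) :
    Qfun U π r γ z ≤ f z := by
  have hbound (n : ℕ) : ∀ z, Qfun U π r γ z - f z ≤ γ ^ n * (1 - γ)⁻¹ := by
    induction n with
    | zero =>
      intro z
      have h1 := (Qfun_mem_Icc (U := U) (π := π) hr hr01 hγ z).2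
      have h2 := (hfM z).1
      simp only [pow_zero, one_mul]
      linarith
    | succ n ih =>
      intro z
      have hQi : Integrable (Qfun U π r γ) (stepKernel U π z) :=
        integrable_of_forall_mem_Icc (measurable_Qfun hr) (Qfun_mem_Icc hr hr01 hγ)
      have hfi : Integrable f (stepKernel U π z) := integrable_of_forall_mem_Icc hf hfM
      have hint := integral_mono (hQi.sub hfi)
        (integrable_const (γ ^ n * (1 - γ)⁻¹)) (fun y => ih y)
      simp only [Pi.sub_apply, integral_const, probReal_univ, smul_eq_mul, one_mul] at hint
      rw [integral_sub hQi hfi] at hint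
      have hmul := mul_le_mul_of_nonneg_left hint hγ.1
      have hQ := Qfun_eq_add_integral (U := U) (π := π) hr hr01 hγ z
      have hz := hsup z
      rw [pow_succ]
      linarith
  have hlim : Filter.Tendsto (fun n : ℕ => γ ^ n * (1 - γ)⁻¹) Filter.atTop (nhds 0) := by
    simpa using (tendsto_pow_atTop_nhds_zero_of_lt_one hγ.1 hγ.2).mul_const (1 - γ)⁻¹
  exact sub_nonpos.1 (ge_of_tendsto' hlim fun n => hbound n z)

end Robust

/-- Identification of the robust `Q`-function: `Q⁻` satisfies the robust Bellman equation
`Q⁻(s,a) = r(s,a) + γ Λ⁻¹ ∫ V⁻ dP(·|s,a) + γ (1 − Λ⁻¹) CVaR⁻_{τ(s,a)}(V⁻; P(·|s,a))`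
with `τ(s,a) = 1/(1+Λ(s,a))`. -/
theorem robust_q_identification
    {S A : Type*} [MeasurableSpace S] [MeasurableSpace A]
    (P : Kernel (S × A) S) [IsMarkovKernel P] (π : Kernel S A) [IsMarkovKernel π]
    (r : S × A → ℝ) (hr_meas : Measurable r) (hr_bdd : ∀ z, r z ∈ Set.Icc (0 : ℝ) 1)
    (γ : ℝ) (hγ : γ ∈ Set.Ico (0 : ℝ) 1)
    (Λ : S × A → ℝ) (hΛ_meas : Measurable Λ) (hΛ_lb : ∀ sa, 1 ≤ Λ sa)
    (MΛ : ℝ) (hΛ_ub : ∀ sa, Λ sa ≤ MΛ)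
    (hQ_meas : Measurable (Qrobust Λ P π r γ)) :
    ∀ sa : S × A,
      Qrobust Λ P π r γ sa =
        r sa + γ * (Λ sa)⁻¹ * (∫ s', Vrobust Λ P π r γ s' ∂(P sa)) +
          γ * (1 - (Λ sa)⁻¹) *
            cvarLower (1 + Λ sa)⁻¹ (Vrobust Λ P π r γ) (P sa) := by
  intro sa
  have hPmem : P ∈ kernelPerturbSet Λ P := self_mem_kernelPerturbSet hΛ_lb
  have : Nonempty (kernelPerturbSet Λ P) := ⟨⟨P, hPmem⟩⟩
  have hQfun (U : kernelPerturbSet Λ P) (z : S × A) :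
      Qfun (U : Kernel (S × A) S) π r γ z ∈ Set.Icc (0 : ℝ) (1 - γ)⁻¹ :=
    have := U.2.1
    Qfun_mem_Icc hr_meas hr_bdd hγ z
  have hbdd (z : S × A) : BddBelow (Set.range fun U : kernelPerturbSet Λ P =>
      Qfun (U : Kernel (S × A) S) π r γ z) :=
    ⟨0, Set.forall_mem_range.2 fun U => (hQfun U z).1⟩
  have hle (U : kernelPerturbSet Λ P) (z : S × A) :
      Qrobust Λ P π r γ z ≤ Qfun (U : Kernel (S × A) S) π r γ z := ciInf_le (hbdd z) U
  have hQ (z : S × A) : Qrobust Λ P π r γ z ∈ Set.Icc (0 : ℝ) (1 - γ)⁻¹ :=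
    ⟨le_ciInf fun U => (hQfun U z).1, (hle ⟨P, hPmem⟩ z).trans (hQfun _ z).2⟩
  have hV_meas : Measurable (Vrobust Λ P π r γ) :=
    (StronglyMeasurable.integral_kernel_prod_right'
      hQ_meas.stronglyMeasurable).measurable
  have hV (s : S) : Vrobust Λ P π r γ s ∈ Set.Icc (0 : ℝ) (1 - γ)⁻¹ :=
    integral_mem_Icc_of_forall (hQ_meas.comp measurable_prodMk_left) fun a => hQ (s, a)
  have hstep (U : kernelPerturbSet Λ P) (z : S × A) :
      ∫ y, Qrobust Λ P π r γ y ∂(stepKernel (U : Kernel (S × A) S) π z)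
        = ∫ s, Vrobust Λ P π r γ s ∂((U : Kernel (S × A) S) z) :=
    have := U.2.1
    integral_stepKernel U.1 π hQ_meas hQ z
  have hlower (z : S × A) : r z + γ * ((Λ z)⁻¹ * ∫ s, Vrobust Λ P π r γ s ∂(P z)
      + (1 - (Λ z)⁻¹) * cvarLower (1 + Λ z)⁻¹ (Vrobust Λ P π r γ) (P z))
      ≤ Qrobust Λ P π r γ z := by
    refine le_ciInf fun U => ?_
    have := U.2.1
    rw [Qfun_eq_add_integral hr_meas hr_bdd hγ z]
    gcongr
    · exact hγ.1
    calc _ ≤ ∫ s, Vrobust Λ P π r γ s ∂((U : Kernel (S × A) S) z) :=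
          cvar_mixture_le_integral (hΛ_lb z) (U.2.2 z).1
            (integrable_of_forall_mem_Icc hV_meas hV)
            (integrable_of_forall_mem_Icc hV_meas hV) (U.2.2 z).2
      _ = ∫ y, Qrobust Λ P π r γ y ∂(stepKernel (U : Kernel (S × A) S) π z) :=
          (hstep U z).symm
      _ ≤ _ := integral_mono (integrable_of_forall_mem_Icc hQ_meas hQ)
          (integrable_of_forall_mem_Icc (measurable_Qfun hr_meas) (hQfun U)) (hle U)
  obtain ⟨U, hU, hworst⟩ := exists_worstCaseKernel (P := P) hΛ_meas hΛ_lb hV_meas hV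
  have := hU.1
  have hsup (z : S × A) : r z + γ * ∫ y, Qrobust Λ P π r γ y ∂(stepKernel U π z)
      ≤ Qrobust Λ P π r γ z := by
    rw [hstep ⟨U, hU⟩ z]
    have := mul_le_mul_of_nonneg_left (hworst z) hγ.1
    linarith [hlower z]
  have heq : Qfun U π r γ = Qrobust Λ P π r γ := funext fun z =>
    le_antisymm (Qfun_le_of_supersolution hr_meas hr_bdd hγ hQ_meas hQ hsup z)
      (hle ⟨U, hU⟩ z)
  have hupper := Qfun_eq_add_integral (U := U) (π := π) hr_meas hr_bdd hγ sa
  rw [heq, hstep ⟨U, hU⟩ sa] at hupper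
  have hmul := mul_le_mul_of_nonneg_left (hworst sa) hγ.1
  linarith [hlower sa]
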